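/- arXiv:1602.07328 — 2 statements merged into one kernel-verified Lean document; each statement's English description precedes it below -/
import Mathlib

section
/- Let C be an abelian category, X a left thick class of objects of C, and Y a right thick class of objects contained in X^∧, such that ω := X ∩ Y is an X-injective relative cogenerator in X. Then Y = ω^∧ = X^∧ ∩ X^⊥ = X^∧ ∩ X^{⊥1} = {C' ∈ X^∧ : id_X(C') < ∞} ∩ ω^⊥. -/
/-!
Common definitions for Auslander–Buchweitz approximation theory in abelian
categories, following Becerril–Mendoza–Pérez–Santiago.
-/

open CategoryTheory CategoryTheory.Limits ZeroObject

universe w v u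

namespace ABFormal

variable {C : Type u} [Category.{v} C] [Abelian C] [CategoryTheory.HasExt.{w} C]

/-- `0 → A → B → C' → 0` is a short exact sequence in `C`. -/
def IsShortExactSeq {A B C' : C} (f : A ⟶ B) (g : B ⟶ C') : Prop :=
  ∃ w : f ≫ g = 0, (ShortComplex.mk f g w).ShortExact

/-- `ωω` is `XX`-injective: `Ext^i(X, W) = 0` for all `X ∈ XX`, `W ∈ ωω` and `i > 0`. -/
def IsRelInjective (XX ωω : Set C) : Prop :=
  ∀ W ∈ ωω, ∀ X ∈ XX, ∀ i : ℕ, 0 < i → Subsingleton (Abelian.Ext.{w} X W i)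

/-- `ωω` is `XX`-projective: `Ext^i(W, X) = 0` for all `X ∈ XX`, `W ∈ ωω` and `i > 0`. -/
def IsRelProjective (XX ωω : Set C) : Prop :=
  ∀ W ∈ ωω, ∀ X ∈ XX, ∀ i : ℕ, 0 < i → Subsingleton (Abelian.Ext.{w} W X i)

/-- `ωω` is a relative cogenerator in `XX`. -/
def IsRelCogenerator (XX ωω : Set C) : Prop :=
  ωω ⊆ XX ∧ ∀ X ∈ XX, ∃ (W X' : C) (i : X ⟶ W) (p : W ⟶ X'),
    W ∈ ωω ∧ X' ∈ XX ∧ IsShortExactSeq i p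

/-- `ωω` is a relative generator in `XX`. -/
def IsRelGenerator (XX ωω : Set C) : Prop :=
  ωω ⊆ XX ∧ ∀ X ∈ XX, ∃ (X' W : C) (i : X' ⟶ W) (p : W ⟶ X),
    W ∈ ωω ∧ X' ∈ XX ∧ IsShortExactSeq i p

/-- `id_XX(M) ≤ n` : `Ext^j(X, M) = 0` for all `X ∈ XX` and `j > n`. -/
def relInjDimLE (XX : Set C) (M : C) (n : ℕ) : Prop :=
  ∀ X ∈ XX, ∀ j : ℕ, n < j → Subsingleton (Abelian.Ext.{w} X M j)

/-- The relative injective dimension `id_XX(M) : ℕ∞`. -/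
noncomputable def relInjDim (XX : Set C) (M : C) : ℕ∞ :=
  sInf {m : ℕ∞ | ∃ n : ℕ, m = (n : ℕ∞) ∧ relInjDimLE XX M n}

/-- `pd_XX(M) ≤ n` : `Ext^j(M, X) = 0` for all `X ∈ XX` and `j > n`. -/
def relProjDimLE (XX : Set C) (M : C) (n : ℕ) : Prop :=
  ∀ X ∈ XX, ∀ j : ℕ, n < j → Subsingleton (Abelian.Ext.{w} M X j)

/-- The relative projective dimension `pd_XX(M) : ℕ∞`. -/
noncomputable def relProjDim (XX : Set C) (M : C) : ℕ∞ :=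
  sInf {m : ℕ∞ | ∃ n : ℕ, m = (n : ℕ∞) ∧ relProjDimLE XX M n}

/-- There is an exact sequence `0 → X_n → ⋯ → X_0 → M → 0` with all `X_i ∈ XX`
(a resolution of length `n`). -/
inductive HasResolutionLength (XX : Set C) : ℕ → C → Prop
  | zero {M X : C} (hX : X ∈ XX) (e : X ≅ M) : HasResolutionLength XX 0 M
  | succ {n : ℕ} {M : C} (K X : C) (hX : X ∈ XX)
      (i : K ⟶ X) (p : X ⟶ M) (hse : IsShortExactSeq i p)
      (hK : HasResolutionLength XX n K) : HasResolutionLength XX (n + 1) M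

/-- The `XX`-resolution dimension `resdim_XX(M) : ℕ∞`. -/
noncomputable def resDim (XX : Set C) (M : C) : ℕ∞ :=
  sInf {m : ℕ∞ | ∃ n : ℕ, m = (n : ℕ∞) ∧ HasResolutionLength XX n M}

/-- `XX^∧`, the class of objects with a finite `XX`-resolution. -/
def resHat (XX : Set C) : Set C :=
  {M | ∃ n : ℕ, HasResolutionLength XX n M}

/-- There is an exact sequence `0 → M → X^0 → ⋯ → X^n → 0` with all `X^i ∈ XX`
(a coresolution of length `n`). -/
inductive HasCoresolutionLength (XX : Set C) : ℕ → C → Prop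
  | zero {M X : C} (hX : X ∈ XX) (e : M ≅ X) : HasCoresolutionLength XX 0 M
  | succ {n : ℕ} {M : C} (X Q : C) (hX : X ∈ XX)
      (i : M ⟶ X) (p : X ⟶ Q) (hse : IsShortExactSeq i p)
      (hQ : HasCoresolutionLength XX n Q) : HasCoresolutionLength XX (n + 1) M

/-- The `XX`-coresolution dimension `coresdim_XX(M) : ℕ∞`. -/
noncomputable def coresDim (XX : Set C) (M : C) : ℕ∞ :=
  sInf {m : ℕ∞ | ∃ n : ℕ, m = (n : ℕ∞) ∧ HasCoresolutionLength XX n M}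

/-- `XX^∨`, the class of objects with a finite `XX`-coresolution. -/
def coresVee (XX : Set C) : Set C :=
  {M | ∃ n : ℕ, HasCoresolutionLength XX n M}

/-- `IsSyzygyOf XX n M K` : there is an exact sequence
`0 → K → X_{n-1} → ⋯ → X_0 → M → 0` with all `X_i ∈ XX`. -/
inductive IsSyzygyOf (XX : Set C) : ℕ → C → C → Prop
  | zero {M K : C} (e : K ≅ M) : IsSyzygyOf XX 0 M K
  | succ {n : ℕ} {M : C} (K X L : C) (hX : X ∈ XX)
      (i : K ⟶ X) (p : X ⟶ L) (hse : IsShortExactSeq i p)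
      (hL : IsSyzygyOf XX n M L) : IsSyzygyOf XX (n + 1) M K

/-- `XX^⊥ = {N | Ext^i(X, N) = 0 for all X ∈ XX, i > 0}`. -/
def rightPerp (XX : Set C) : Set C :=
  {N | ∀ X ∈ XX, ∀ i : ℕ, 0 < i → Subsingleton (Abelian.Ext.{w} X N i)}

/-- `XX^{⊥₁} = {N | Ext^1(X, N) = 0 for all X ∈ XX}`. -/
def rightPerp1 (XX : Set C) : Set C :=
  {N | ∀ X ∈ XX, Subsingleton (Abelian.Ext.{w} X N 1)}

/-- `^⊥XX = {N | Ext^i(N, X) = 0 for all X ∈ XX, i > 0}`. -/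
def leftPerp (XX : Set C) : Set C :=
  {N | ∀ X ∈ XX, ∀ i : ℕ, 0 < i → Subsingleton (Abelian.Ext.{w} N X i)}

/-- `^{⊥₁}XX = {N | Ext^1(N, X) = 0 for all X ∈ XX}`. -/
def leftPerp1 (XX : Set C) : Set C :=
  {N | ∀ X ∈ XX, Subsingleton (Abelian.Ext.{w} N X 1)}

/-- Closed under extensions. -/
def ClosedUnderExtensions (XX : Set C) : Prop :=
  ∀ ⦃A B C' : C⦄ (f : A ⟶ B) (g : B ⟶ C'), IsShortExactSeq f g →
    A ∈ XX → C' ∈ XX → B ∈ XX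

/-- Closed under kernels of epimorphisms between objects of the class. -/
def ClosedUnderKernelsOfEpis (XX : Set C) : Prop :=
  ∀ ⦃A B C' : C⦄ (f : A ⟶ B) (g : B ⟶ C'), IsShortExactSeq f g →
    B ∈ XX → C' ∈ XX → A ∈ XX

/-- Closed under cokernels of monomorphisms between objects of the class. -/
def ClosedUnderCokernelsOfMonos (XX : Set C) : Prop :=
  ∀ ⦃A B C' : C⦄ (f : A ⟶ B) (g : B ⟶ C'), IsShortExactSeq f g →
    A ∈ XX → B ∈ XX → C' ∈ XX

/-- Closed under direct summands (retracts) in `C`. -/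
def ClosedUnderSummands (XX : Set C) : Prop :=
  ∀ ⦃X A : C⦄, X ∈ XX → ∀ (s : A ⟶ X) (r : X ⟶ A), s ≫ r = 𝟙 A → A ∈ XX

/-- Pre-resolving class: closed under extensions and kernels of epimorphisms. -/
def IsPreresolving (XX : Set C) : Prop :=
  ClosedUnderExtensions XX ∧ ClosedUnderKernelsOfEpis XX

/-- Pre-coresolving class: closed under extensions and cokernels of monomorphisms. -/
def IsPrecoresolving (XX : Set C) : Prop :=
  ClosedUnderExtensions XX ∧ ClosedUnderCokernelsOfMonos XX

/-- Left thick class. -/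
def IsLeftThick (XX : Set C) : Prop :=
  IsPreresolving XX ∧ ClosedUnderSummands XX

/-- Right thick class. -/
def IsRightThick (XX : Set C) : Prop :=
  IsPrecoresolving XX ∧ ClosedUnderSummands XX

/-- Thick class. -/
def IsThickClass (XX : Set C) : Prop :=
  IsLeftThick XX ∧ IsRightThick XX

/-- The smallest thick class of `C` containing `S`. -/
def thickClosure (S : Set C) : Set C :=
  ⋂₀ {T : Set C | IsThickClass T ∧ S ⊆ T}

/-- The class of projective objects of `C`. -/
def ProjClass (C : Type u) [Category.{v} C] : Set C := {P | Projective P}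

/-- The class of injective objects of `C`. -/
def InjClass (C : Type u) [Category.{v} C] : Set C := {I | Injective I}

/-- Resolving class in `C`: pre-resolving and containing all projectives. -/
def IsResolvingClass (XX : Set C) : Prop :=
  IsPreresolving XX ∧ ProjClass C ⊆ XX

/-- Coresolving class in `C`: pre-coresolving and containing all injectives. -/
def IsCoresolvingClass (XX : Set C) : Prop :=
  IsPrecoresolving XX ∧ InjClass C ⊆ XX

/-- A left Frobenius pair `(XX, ωω)` in `C`. -/
structure LeftFrobeniusPair (XX ωω : Set C) : Prop where
  leftThick : IsLeftThick XX
  relInj : IsRelInjective XX ωω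
  relCogen : IsRelCogenerator XX ωω
  summands : ClosedUnderSummands ωω

/-- A strong left Frobenius pair `(XX, ωω)` in `C`. -/
structure StrongLeftFrobeniusPair (XX ωω : Set C) extends LeftFrobeniusPair XX ωω : Prop where
  relProj : IsRelProjective XX ωω
  relGen : IsRelGenerator XX ωω

/-- A right Frobenius pair `(νν, YY)` in `C`. -/
structure RightFrobeniusPair (νν YY : Set C) : Prop where
  rightThick : IsRightThick YY
  relProj : IsRelProjective YY νν
  relGen : IsRelGenerator YY νν
  summands : ClosedUnderSummands νν

/-- `φ : X ⟶ M` is an `XX`-precover of `M`. -/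
def IsPrecover (XX : Set C) {X M : C} (φ : X ⟶ M) : Prop :=
  X ∈ XX ∧ ∀ (X' : C), X' ∈ XX → ∀ f : X' ⟶ M, ∃ h : X' ⟶ X, h ≫ φ = f

/-- `φ : M ⟶ Y` is an `XX`-preenvelope of `M`. -/
def IsPreenvelope (XX : Set C) {M Y : C} (φ : M ⟶ Y) : Prop :=
  Y ∈ XX ∧ ∀ (Y' : C), Y' ∈ XX → ∀ f : M ⟶ Y', ∃ h : Y ⟶ Y', φ ≫ h = f

/-- A left `S`-cotorsion pair `(F, G)` in `C`. -/
def IsLeftCotorsionPair (S F G : Set C) : Prop :=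
  F ⊆ S ∧ G ⊆ S ∧
  F = {A | A ∈ S ∧ ∀ G' ∈ G, Subsingleton (Abelian.Ext.{w} A G' 1)} ∧
  ∀ s ∈ S, ∃ (G' F' : C) (i : G' ⟶ F') (p : F' ⟶ s),
    G' ∈ G ∧ F' ∈ F ∧ IsShortExactSeq i p

/-- A right `S`-cotorsion pair `(F, G)` in `C`. -/
def IsRightCotorsionPair (S F G : Set C) : Prop :=
  F ⊆ S ∧ G ⊆ S ∧
  G = {A | A ∈ S ∧ ∀ F' ∈ F, Subsingleton (Abelian.Ext.{w} F' A 1)} ∧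
  ∀ s ∈ S, ∃ (G' F' : C) (i : s ⟶ G') (p : G' ⟶ F'),
    G' ∈ G ∧ F' ∈ F ∧ IsShortExactSeq i p

/-- An `S`-cotorsion pair `(F, G)` in `C`. -/
def IsCotorsionPair (S F G : Set C) : Prop :=
  IsLeftCotorsionPair S F G ∧ IsRightCotorsionPair S F G

/-- A left weak AB context `(AA, BB)` in `C`. -/
structure LeftWeakABContext (AA BB : Set C) : Prop where
  frob : LeftFrobeniusPair AA (AA ∩ BB)
  rightThick : IsRightThick BB
  sub : BB ⊆ resHat AA

omit [HasExt.{w} C] in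
theorem IsShortExactSeq.mono {A B D : C} {f : A ⟶ B} {g : B ⟶ D} (h : IsShortExactSeq f g) :
    Mono f := by
  obtain ⟨_, h⟩ := h
  exact h.mono_f

omit [HasExt.{w} C] in
/-- The pushout of a short exact sequence along a morphism out of its first term. -/
theorem IsShortExactSeq.pushout {A B D E : C} {f : A ⟶ B} {g : B ⟶ D}
    (h : IsShortExactSeq f g) (a : A ⟶ E) :
    ∃ q : pushout f a ⟶ D, IsShortExactSeq (pushout.inr f a) q := by
  obtain ⟨w, h⟩ := h
  have : Mono f := h.mono_f
  have : Epi g := h.epi_g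
  let q : Limits.pushout f a ⟶ D := pushout.desc g 0 (by simpa using w)
  have hq : pushout.inl f a ≫ q = g := pushout.inl_desc _ _ _
  have w' : pushout.inr f a ≫ q = 0 := pushout.inr_desc _ _ _
  have : Epi q := epi_of_epi_fac hq
  refine ⟨q, w', ?_⟩
  refine { exact := ShortComplex.exact_of_g_is_cokernel _ ?_, mono_f := ?_, epi_g := this }
  · refine CokernelCofork.IsColimit.ofπ' q w' fun {Z} k hk => ?_
    have hk' : f ≫ pushout.inl f a ≫ k = 0 := by
      rw [pushout.condition_assoc, hk, comp_zero]
    refine ⟨h.gIsCokernel.desc (CokernelCofork.ofπ (pushout.inl f a ≫ k) hk'), ?_⟩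
    have hd : g ≫ h.gIsCokernel.desc (CokernelCofork.ofπ (pushout.inl f a ≫ k) hk') =
        pushout.inl f a ≫ k :=
      h.gIsCokernel.fac (CokernelCofork.ofπ (pushout.inl f a ≫ k) hk') WalkingParallelPair.one
    apply pushout.hom_ext
    · rw [reassoc_of% hq, hd]
    · rw [reassoc_of% w', zero_comp, hk]
  · exact inferInstanceAs (Mono (pushout.inr f a))

omit [HasExt.{w} C] in
/-- Composing the monomorphism of a short exact sequence with a further monomorphism `a`: the
cokernel is the pushout of the epimorphism of the sequence along `a`. -/
theorem IsShortExactSeq.comp_mono {A B D E : C} {f : A ⟶ B} {g : B ⟶ D}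
    (h : IsShortExactSeq f g) (a : B ⟶ E) [Mono a] :
    IsShortExactSeq (f ≫ a) (pushout.inl a g) := by
  obtain ⟨w, h⟩ := h
  have : Mono f := h.mono_f
  have : Epi g := h.epi_g
  have w' : (f ≫ a) ≫ pushout.inl a g = 0 := by
    rw [Category.assoc, pushout.condition, reassoc_of% w, zero_comp]
  refine ⟨w', { exact := ShortComplex.exact_of_g_is_cokernel _ ?_, mono_f := ?_, epi_g := ?_ }⟩
  · refine CokernelCofork.IsColimit.ofπ' (pushout.inl a g) w' fun {Z} k hk => ?_
    have hk' : f ≫ a ≫ k = 0 := by rw [← Category.assoc, hk]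
    exact ⟨pushout.desc k (h.gIsCokernel.desc (CokernelCofork.ofπ (a ≫ k) hk'))
      (h.gIsCokernel.fac (CokernelCofork.ofπ (a ≫ k) hk') WalkingParallelPair.one).symm,
      pushout.inl_desc _ _ _⟩
  · exact inferInstanceAs (Mono (f ≫ a))
  · exact inferInstanceAs (Epi (pushout.inl a g))

omit [HasExt.{w} C] in
theorem IsShortExactSeq.id_zero (M : C) : IsShortExactSeq (0 : (0 : C) ⟶ M) (𝟙 M) :=
  ⟨zero_comp, (ShortComplex.Splitting.ofIsZeroOfIsIso
    (ShortComplex.mk (0 : (0 : C) ⟶ M) (𝟙 M) zero_comp) (isZero_zero C)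
    (inferInstance : IsIso (𝟙 M))).shortExact⟩

/-- A short exact sequence splits when `Ext¹` of its outer terms vanishes. -/
theorem IsShortExactSeq.exists_retraction {A B D : C} {f : A ⟶ B} {g : B ⟶ D}
    (h : IsShortExactSeq f g) [Subsingleton (Abelian.Ext.{w} D A 1)] :
    ∃ r : B ⟶ A, f ≫ r = 𝟙 A := by
  obtain ⟨_, h⟩ := h
  obtain ⟨x, hx⟩ := Abelian.Ext.contravariant_sequence_exact₁ h A
    (Abelian.Ext.mk₀ (𝟙 A)) (add_zero 1) (Subsingleton.elim _ _)
  obtain ⟨r, rfl⟩ := (Abelian.Ext.mk₀_bijective _ _).2 x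
  rw [Abelian.Ext.mk₀_comp_mk₀] at hx
  exact ⟨r, (Abelian.Ext.mk₀_bijective _ _).1 hx⟩

theorem IsShortExactSeq.subsingleton_ext_right {A B D : C} {f : A ⟶ B} {g : B ⟶ D}
    (h : IsShortExactSeq f g) (X : C) (n : ℕ) [Subsingleton (Abelian.Ext.{w} X B n)]
    [Subsingleton (Abelian.Ext.{w} X A (n + 1))] : Subsingleton (Abelian.Ext.{w} X D n) := by
  obtain ⟨_, h⟩ := h
  refine subsingleton_of_forall_eq 0 fun x => ?_
  obtain ⟨y, rfl⟩ := Abelian.Ext.covariant_sequence_exact₃ X h x rfl (Subsingleton.elim _ _)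
  rw [Subsingleton.elim (α := Abelian.Ext.{w} X B n) y 0, Abelian.Ext.zero_comp]

theorem IsShortExactSeq.subsingleton_ext_left {A B D : C} {f : A ⟶ B} {g : B ⟶ D}
    (h : IsShortExactSeq f g) (M : C) (n : ℕ) [Subsingleton (Abelian.Ext.{w} B M n)]
    [Subsingleton (Abelian.Ext.{w} D M (n + 1))] : Subsingleton (Abelian.Ext.{w} A M n) := by
  obtain ⟨_, h⟩ := h
  have : Subsingleton (Abelian.Ext.{w} D M (1 + n)) := by rwa [add_comm]
  refine subsingleton_of_forall_eq 0 fun x => ?_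
  obtain ⟨y, rfl⟩ := Abelian.Ext.contravariant_sequence_exact₁ h M x rfl (Subsingleton.elim _ _)
  rw [Subsingleton.elim (α := Abelian.Ext.{w} B M n) y 0, Abelian.Ext.comp_zero]

omit [Abelian C] [HasExt.{w} C] in
theorem ClosedUnderSummands.mem_of_iso {XX : Set C} (h : ClosedUnderSummands XX) {A B : C}
    (e : A ≅ B) (hA : A ∈ XX) : B ∈ XX :=
  h hA e.inv e.hom e.inv_hom_id

omit [HasExt.{w} C] in
theorem ClosedUnderSummands.zero_mem {XX : Set C} (h : ClosedUnderSummands XX) {A : C}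
    (hA : A ∈ XX) : (0 : C) ∈ XX :=
  h hA 0 0 ((isZero_zero C).eq_of_src _ _)

omit [HasExt.{w} C] in
/-- Objects with a finite resolution by a class are in any larger class closed under
isomorphisms and cokernels of monomorphisms. -/
theorem resHat_subset {WW YY : Set C} (hsub : WW ⊆ YY) (hcok : ClosedUnderCokernelsOfMonos YY)
    (hsum : ClosedUnderSummands YY) : resHat WW ⊆ YY := by
  rintro M ⟨n, h⟩
  induction h with
  | zero hX e => exact hsum.mem_of_iso e (hsub hX)
  | succ K X hX i p hse _ ih => exact hcok i p hse ih (hsub hX)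

theorem subsingleton_ext_of_iso {X W M : C} (e : W ≅ M) (i : ℕ)
    [Subsingleton (Abelian.Ext.{w} X W i)] : Subsingleton (Abelian.Ext.{w} X M i) := by
  refine subsingleton_of_forall_eq 0 fun x => ?_
  have hx : (x.comp (Abelian.Ext.mk₀ e.inv) (add_zero i)).comp
      (Abelian.Ext.mk₀ e.hom) (add_zero i) = x := by simp
  rw [← hx, Subsingleton.elim (x.comp (Abelian.Ext.mk₀ e.inv) (add_zero i)) 0,
    Abelian.Ext.zero_comp]

theorem IsRelInjective.resHat_subset_rightPerp {XX WW : Set C}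
    (hinj : IsRelInjective.{w} XX WW) : resHat WW ⊆ rightPerp.{w} XX := by
  rintro M ⟨n, h⟩
  induction h with
  | zero hW e =>
    intro X hX i hi
    have := hinj _ hW X hX i hi
    exact subsingleton_ext_of_iso e i
  | succ K W hW f p hse _ ih =>
    intro X hX i hi
    have := hinj W hW X hX i hi
    have := ih X hX (i + 1) i.succ_pos
    exact hse.subsingleton_ext_right X i

omit [HasExt.{w} C] in
theorem mem_resHat {WW : Set C} {W : C} (hW : W ∈ WW) : W ∈ resHat WW :=
  ⟨0, .zero hW (Iso.refl W)⟩

omit [HasExt.{w} C] in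
theorem mem_resHat_of_shortExact {WW : Set C} {K W M : C} {i : K ⟶ W} {p : W ⟶ M}
    (hse : IsShortExactSeq i p) (hK : K ∈ resHat WW) (hW : W ∈ WW) : M ∈ resHat WW := by
  obtain ⟨n, hK⟩ := hK
  exact ⟨n + 1, .succ K W hW i p hse hK⟩

omit [HasExt.{w} C] in
/-- The Auslander–Buchweitz approximations of an object of `XX^∧`: an `XX`-precover with kernel
in `WW^∧`, and a `WW^∧`-preenvelope with cokernel in `XX`. -/
theorem exists_approximations {XX WW : Set C} (hext : ClosedUnderExtensions XX)
    (hXsum : ClosedUnderSummands XX) (hWsum : ClosedUnderSummands WW)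
    (hcog : IsRelCogenerator XX WW) {M : C} (hM : M ∈ resHat XX) :
    (∃ (K X : C) (i : K ⟶ X) (p : X ⟶ M),
      K ∈ resHat WW ∧ X ∈ XX ∧ IsShortExactSeq i p) ∧
    ∃ (H X : C) (i : M ⟶ H) (p : H ⟶ X),
      H ∈ resHat WW ∧ X ∈ XX ∧ IsShortExactSeq i p := by
  obtain ⟨n, h⟩ := hM
  induction h with
  | @zero M X hX e =>
    have hM : M ∈ XX := hXsum.mem_of_iso e hX
    obtain ⟨W, X', i, p, hW, hX', hse⟩ := hcog.2 M hM
    exact ⟨⟨0, M, 0, 𝟙 M, mem_resHat (hWsum.zero_mem hW), hM, .id_zero M⟩,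
      W, X', i, p, mem_resHat hW, hX', hse⟩
  | @succ n M K X hX i p hse _ ih =>
    obtain ⟨-, H, X', j, q, hH, hX', hse'⟩ := ih
    have := hse'.mono
    obtain ⟨r, hr⟩ := hse.pushout j
    obtain ⟨s, hs⟩ := hse'.pushout i
    have hP : pushout i j ∈ XX :=
      hXsum.mem_of_iso (pushoutSymmetry j i) (hext _ _ hs hX hX')
    obtain ⟨W, X'', a, c, hW, hX'', ha⟩ := hcog.2 _ hP
    have := ha.mono
    obtain ⟨t, ht⟩ := ha.pushout r
    exact ⟨⟨H, _, _, r, hH, hP, hr⟩, _, X'', _, t,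
      mem_resHat_of_shortExact (hr.comp_mono a) hH hW, hX'', ht⟩

theorem exists_relInjDimLE_of_relInjDim_lt_top {XX : Set C} {M : C}
    (h : relInjDim.{w} XX M < ⊤) : ∃ n : ℕ, relInjDimLE.{w} XX M n := by
  obtain ⟨_, ⟨n, -, hn⟩, -⟩ := sInf_lt_iff.1 h
  exact ⟨n, hn⟩

theorem relInjDim_lt_top_of_relInjDimLE {XX : Set C} {M : C} {n : ℕ}
    (h : relInjDimLE.{w} XX M n) : relInjDim.{w} XX M < ⊤ :=
  sInf_lt_iff.2 ⟨n, ⟨n, rfl, h⟩, ENat.natCast_lt_top n⟩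

/-- An object of finite relative injective dimension which is right orthogonal to a relative
cogenerator is right orthogonal to the whole class. -/
theorem mem_rightPerp_of_relInjDimLE {XX WW : Set C} (hcog : IsRelCogenerator XX WW) {M : C}
    (hM : M ∈ rightPerp.{w} WW) {n : ℕ} (h : relInjDimLE.{w} XX M n) : M ∈ rightPerp.{w} XX := by
  induction n with
  | zero => exact h
  | succ n ih =>
    refine ih fun X hX j hj => ?_
    obtain ⟨W, X', i, p, hW, hX', hse⟩ := hcog.2 X hX
    have := hM W hW j (by omega)
    have := h X' hX' (j + 1) (by omega)
    exact hse.subsingleton_ext_left M j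

/-- Theorem of Auslander–Buchweitz–Reiten. Let `X` be left thick,
`Y` right thick with `Y ⊆ X^∧`, and suppose `ω := X ∩ Y` is an `X`-injective relative
cogenerator in `X`. Then
`Y = ω^∧ = X^∧ ∩ X^⊥ = X^∧ ∩ X^{⊥1} = {C' ∈ X^∧ : id_X(C') < ∞} ∩ ω^⊥`. -/
theorem stmt11 (XX YY : Set C) (hX : IsLeftThick XX) (hY : IsRightThick YY)
    (hYsub : YY ⊆ resHat XX)
    (hinj : IsRelInjective XX (XX ∩ YY)) (hcog : IsRelCogenerator XX (XX ∩ YY)) :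
    YY = resHat (XX ∩ YY) ∧
    YY = resHat XX ∩ rightPerp XX ∧
    YY = resHat XX ∩ rightPerp1 XX ∧
    YY = {A | A ∈ resHat XX ∧ relInjDim XX A < ⊤} ∩ rightPerp (XX ∩ YY) := by
  obtain ⟨⟨hXext, -⟩, hXsum⟩ := hX
  obtain ⟨⟨hYext, hYcok⟩, hYsum⟩ := hY
  have hWsum : ClosedUnderSummands (XX ∩ YY) := fun _ _ hX s r hsr =>
    ⟨hXsum hX.1 s r hsr, hYsum hX.2 s r hsr⟩
  have hHat_sub : resHat (XX ∩ YY) ⊆ YY := resHat_subset Set.inter_subset_right hYcok hYsum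
  have hsub_hat : YY ⊆ resHat (XX ∩ YY) := fun M hM => by
    obtain ⟨⟨K, X, i, p, hK, hX, hse⟩, -⟩ :=
      exists_approximations hXext hXsum hWsum hcog (hYsub hM)
    exact mem_resHat_of_shortExact hse hK ⟨hX, hYext i p hse (hHat_sub hK) hM⟩
  have hperp : YY ⊆ rightPerp XX := hsub_hat.trans hinj.resHat_subset_rightPerp
  have hperp_sub : rightPerp XX ⊆ rightPerp1 XX := fun M hM X hX => hM X hX 1 one_pos
  have hperp1 : resHat XX ∩ rightPerp1 XX ⊆ YY := fun M hM => by
    obtain ⟨-, H, X, i, p, hH, hX, hse⟩ :=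
      exists_approximations hXext hXsum hWsum hcog hM.1
    have := hM.2 X hX
    obtain ⟨r, hr⟩ := hse.exists_retraction
    exact hYsum (hHat_sub hH) i r hr
  refine ⟨hsub_hat.antisymm hHat_sub, Set.Subset.antisymm ?_ ?_, Set.Subset.antisymm ?_ hperp1,
    Set.Subset.antisymm ?_ ?_⟩
  · exact fun M hM => ⟨hYsub hM, hperp hM⟩
  · exact fun M hM => hperp1 ⟨hM.1, hperp_sub hM.2⟩
  · exact fun M hM => ⟨hYsub hM, hperp_sub (hperp hM)⟩
  · exact fun M hM => ⟨⟨hYsub hM, relInjDim_lt_top_of_relInjDimLE (n := 0) (hperp hM)⟩,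
      fun X hX => hperp hM X hX.1⟩
  · rintro M ⟨⟨hM, hfin⟩, hW⟩
    obtain ⟨n, hn⟩ := exists_relInjDimLE_of_relInjDim_lt_top hfin
    exact hperp1 ⟨hM, hperp_sub (mem_rightPerp_of_relInjDimLE hcog hW hn)⟩

end ABFormal
end

section
/- Let C be an abelian category with enough projectives, S a thick class of objects of C, and (F,G) an S-cotorsion pair in C such that F is resolving in C; set ω := F ∩ G. Then: (a) Ext^i_C(F,G) = 0 for all F ∈ F, G ∈ G, and i ≥ 1; (b) (F,ω) is a left Frobenius pair in C; (c) (ω,G) is a right Frobenius pair in C; (d) if G ⊆ F^∧, then (F,G) is an F^∧-cotorsion pair in C and G = ω^∧ = F^∧ ∩ F^⊥ and F = F^∧ ∩ ^⊥ω = F^∧ ∩ ^⊥(ω^∧). -/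
/-!
Common definitions for Auslander–Buchweitz approximation theory in abelian
categories, following Becerril–Mendoza–Pérez–Santiago.
-/

open CategoryTheory CategoryTheory.Limits ZeroObject

universe w v u

namespace ABFormal

variable {C : Type u} [Category.{v} C] [Abelian C] [CategoryTheory.HasExt.{w} C]

namespace IsShortExactSeq

variable {A B D : C} {f : A ⟶ B} {g : B ⟶ D}

lemma subsingleton_ext_middle_right (h : IsShortExactSeq f g) (X : C) (n : ℕ)
    [Subsingleton (Abelian.Ext.{w} X A n)] [Subsingleton (Abelian.Ext.{w} X D n)] :
    Subsingleton (Abelian.Ext.{w} X B n) := by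
  obtain ⟨_, hse⟩ := h
  refine subsingleton_of_forall_eq 0 fun x ↦ ?_
  obtain ⟨y, rfl⟩ := Abelian.Ext.covariant_sequence_exact₂ X hse x (Subsingleton.elim _ _)
  rw [Subsingleton.elim y 0, Abelian.Ext.zero_comp]

lemma subsingleton_ext_cokernel_right (h : IsShortExactSeq f g) (X : C) (n : ℕ)
    [Subsingleton (Abelian.Ext.{w} X B n)] [Subsingleton (Abelian.Ext.{w} X A (n + 1))] :
    Subsingleton (Abelian.Ext.{w} X D n) := by
  obtain ⟨_, hse⟩ := h
  refine subsingleton_of_forall_eq 0 fun x ↦ ?_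
  obtain ⟨y, rfl⟩ := Abelian.Ext.covariant_sequence_exact₃ X hse x rfl (Subsingleton.elim _ _)
  rw [Subsingleton.elim y 0, Abelian.Ext.zero_comp]

lemma subsingleton_ext_middle_left (h : IsShortExactSeq f g) (Y : C) (n : ℕ)
    [Subsingleton (Abelian.Ext.{w} A Y n)] [Subsingleton (Abelian.Ext.{w} D Y n)] :
    Subsingleton (Abelian.Ext.{w} B Y n) := by
  obtain ⟨_, hse⟩ := h
  refine subsingleton_of_forall_eq 0 fun x ↦ ?_
  obtain ⟨y, rfl⟩ := Abelian.Ext.contravariant_sequence_exact₂ hse Y x (Subsingleton.elim _ _)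
  rw [Subsingleton.elim y 0, Abelian.Ext.comp_zero]

lemma subsingleton_ext_kernel_left (h : IsShortExactSeq f g) (Y : C) (n : ℕ)
    [Subsingleton (Abelian.Ext.{w} B Y n)] [Subsingleton (Abelian.Ext.{w} D Y (n + 1))] :
    Subsingleton (Abelian.Ext.{w} A Y n) := by
  obtain ⟨_, hse⟩ := h
  refine subsingleton_of_forall_eq 0 fun x ↦ ?_
  obtain ⟨y, rfl⟩ := Abelian.Ext.contravariant_sequence_exact₁ hse Y x (add_comm 1 n)
    (Subsingleton.elim _ _)
  rw [Subsingleton.elim y 0, Abelian.Ext.comp_zero]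

lemma subsingleton_ext_cokernel_left (h : IsShortExactSeq f g) (Y : C) (n : ℕ)
    [Subsingleton (Abelian.Ext.{w} A Y n)] [Subsingleton (Abelian.Ext.{w} B Y (n + 1))] :
    Subsingleton (Abelian.Ext.{w} D Y (n + 1)) := by
  obtain ⟨_, hse⟩ := h
  refine subsingleton_of_forall_eq 0 fun x ↦ ?_
  obtain ⟨y, rfl⟩ := Abelian.Ext.contravariant_sequence_exact₃ hse Y x (Subsingleton.elim _ _)
    (add_comm 1 n)
  rw [Subsingleton.elim y 0, Abelian.Ext.comp_zero]

end IsShortExactSeq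

lemma subsingleton_ext_of_retract_left {X A : C} (s : A ⟶ X) (r : X ⟶ A) (h : s ≫ r = 𝟙 A)
    (Y : C) (n : ℕ) [Subsingleton (Abelian.Ext.{w} X Y n)] :
    Subsingleton (Abelian.Ext.{w} A Y n) := by
  refine subsingleton_of_forall_eq 0 fun x ↦ ?_
  rw [← Abelian.Ext.mk₀_id_comp x, ← h, ← Abelian.Ext.mk₀_comp_mk₀_assoc,
    Subsingleton.elim ((Abelian.Ext.mk₀ r).comp x (zero_add n)) 0, Abelian.Ext.comp_zero]

lemma subsingleton_ext_of_retract_right {X A : C} (s : A ⟶ X) (r : X ⟶ A) (h : s ≫ r = 𝟙 A)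
    (Z : C) (n : ℕ) [Subsingleton (Abelian.Ext.{w} Z X n)] :
    Subsingleton (Abelian.Ext.{w} Z A n) := by
  refine subsingleton_of_forall_eq 0 fun x ↦ ?_
  rw [← Abelian.Ext.comp_mk₀_id x, ← h, ← Abelian.Ext.mk₀_comp_mk₀,
    ← Abelian.Ext.comp_assoc_of_third_deg_zero,
    Subsingleton.elim (x.comp (Abelian.Ext.mk₀ s) (add_zero n)) 0, Abelian.Ext.zero_comp]

lemma ClosedUnderSummands.inter {X Y : Set C} (hX : ClosedUnderSummands X)
    (hY : ClosedUnderSummands Y) : ClosedUnderSummands (X ∩ Y) :=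
  fun _ _ h s r hsr ↦ ⟨hX h.1 s r hsr, hY h.2 s r hsr⟩

lemma subset_resHat (X : Set C) : X ⊆ resHat X :=
  fun M hM ↦ ⟨0, .zero hM (Iso.refl M)⟩

lemma HasResolutionLength.mem_of_isRightThick {X Y : Set C} (hY : IsRightThick Y) (hXY : X ⊆ Y)
    {n : ℕ} {M : C} (h : HasResolutionLength X n M) : M ∈ Y := by
  induction h with
  | zero hX e => exact hY.2 (hXY hX) e.inv e.hom e.inv_hom_id
  | succ K X' hX i p hse _ ih => exact hY.1.2 i p hse ih (hXY hX)

lemma resHat_subset_s16 {X Y : Set C} (hY : IsRightThick Y) (hXY : X ⊆ Y) : resHat X ⊆ Y :=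
  fun _ ⟨_, h⟩ ↦ h.mem_of_isRightThick hY hXY

lemma HasResolutionLength.relProjDimLE {X Y : Set C} (hXY : IsRelProjective.{w} Y X)
    {n : ℕ} {M : C} (h : HasResolutionLength X n M) : relProjDimLE.{w} Y M n := by
  induction h with
  | zero hX e =>
    intro Z hZ j hj
    have := hXY _ hX Z hZ j hj
    exact subsingleton_ext_of_retract_left e.inv e.hom e.inv_hom_id Z j
  | succ K X' hX i p hse _ ih =>
    intro Z hZ j hj
    obtain ⟨j, rfl⟩ : ∃ k, j = k + 1 := ⟨j - 1, by lia⟩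
    have := ih Z hZ j (by lia)
    have := hXY _ hX Z hZ (j + 1) j.succ_pos
    exact hse.subsingleton_ext_cokernel_left Z j

lemma HasResolutionLength.subsingleton_ext {X : Set C} {M : C} (hM : M ∈ leftPerp.{w} X)
    {n : ℕ} {N : C} (h : HasResolutionLength X n N) (i : ℕ) (hi : 0 < i) :
    Subsingleton (Abelian.Ext.{w} M N i) := by
  induction h generalizing i with
  | zero hX e =>
    have := hM _ hX i hi
    exact subsingleton_ext_of_retract_right e.inv e.hom e.inv_hom_id M i
  | succ K X' hX f p hse _ ih =>
    have := hM _ hX i hi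
    have := ih (i + 1) i.succ_pos
    exact hse.subsingleton_ext_cokernel_right M i

lemma leftPerp_subset_leftPerp_resHat (X : Set C) : leftPerp.{w} X ⊆ leftPerp.{w} (resHat X) :=
  fun _ hM _ ⟨_, h⟩ i hi ↦ h.subsingleton_ext hM i hi

/-- If `C` has enough projectives and `X` is resolving, vanishing of `Ext¹` against `X` implies
vanishing of all higher `Ext`. -/
lemma IsResolvingClass.rightPerp1_subset_rightPerp [EnoughProjectives C] {X : Set C}
    (hX : IsResolvingClass X) : rightPerp1.{w} X ⊆ rightPerp.{w} X := by
  intro N hN Z hZ i hi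
  induction i, hi using Nat.le_induction generalizing Z with
  | base => exact hN Z hZ
  | succ n hn ih =>
    have hse : IsShortExactSeq (kernel.ι (Projective.π Z)) (Projective.π Z) :=
      ⟨kernel.condition _, { exact := ShortComplex.exact_kernel _ }⟩
    have := ih _ (hX.1.2 _ _ hse (hX.2 (Projective.projective_over Z)) hZ)
    have := Abelian.Ext.subsingleton_of_projective.{w} (Projective.over Z) N n
    exact hse.subsingleton_ext_cokernel_left N n

namespace IsCotorsionPair

variable {S F G : Set C}

lemma mem_left_iff (h : IsCotorsionPair.{w} S F G) {A : C} :
    A ∈ F ↔ A ∈ S ∧ A ∈ leftPerp1.{w} G :=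
  Set.ext_iff.1 h.1.2.2.1 A

lemma mem_right_iff (h : IsCotorsionPair.{w} S F G) {A : C} :
    A ∈ G ↔ A ∈ S ∧ A ∈ rightPerp1.{w} F :=
  Set.ext_iff.1 h.2.2.2.1 A

lemma closedUnderSummands_left (h : IsCotorsionPair.{w} S F G) (hS : ClosedUnderSummands S) :
    ClosedUnderSummands F := by
  intro X A hX s r hsr
  rw [h.mem_left_iff] at hX ⊢
  refine ⟨hS hX.1 s r hsr, fun Y hY ↦ ?_⟩
  have := hX.2 Y hY
  exact subsingleton_ext_of_retract_left s r hsr Y 1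

lemma closedUnderSummands_right (h : IsCotorsionPair.{w} S F G) (hS : ClosedUnderSummands S) :
    ClosedUnderSummands G := by
  intro X A hX s r hsr
  rw [h.mem_right_iff] at hX ⊢
  refine ⟨hS hX.1 s r hsr, fun Z hZ ↦ ?_⟩
  have := hX.2 Z hZ
  exact subsingleton_ext_of_retract_right s r hsr Z 1

lemma closedUnderExtensions_left (h : IsCotorsionPair.{w} S F G) (hS : ClosedUnderExtensions S) :
    ClosedUnderExtensions F := by
  intro A B D f g hfg hA hD
  rw [h.mem_left_iff] at hA hD ⊢
  refine ⟨hS f g hfg hA.1 hD.1, fun Y hY ↦ ?_⟩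
  have := hA.2 Y hY
  have := hD.2 Y hY
  exact hfg.subsingleton_ext_middle_left Y 1

lemma closedUnderExtensions_right (h : IsCotorsionPair.{w} S F G) (hS : ClosedUnderExtensions S) :
    ClosedUnderExtensions G := by
  intro A B D f g hfg hA hD
  rw [h.mem_right_iff] at hA hD ⊢
  refine ⟨hS f g hfg hA.1 hD.1, fun Z hZ ↦ ?_⟩
  have := hA.2 Z hZ
  have := hD.2 Z hZ
  exact hfg.subsingleton_ext_middle_right Z 1

lemma isRelCogenerator (h : IsCotorsionPair.{w} S F G) (hS : ClosedUnderExtensions S) :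
    IsRelCogenerator F (F ∩ G) := by
  refine ⟨Set.inter_subset_left, fun X hX ↦ ?_⟩
  obtain ⟨W, X', i, p, hW, hX', hse⟩ := h.2.2.2.2 X (h.1.1 hX)
  exact ⟨W, X', i, p, ⟨h.closedUnderExtensions_left hS i p hse hX hX', hW⟩, hX', hse⟩

lemma isRelGenerator (h : IsCotorsionPair.{w} S F G) (hS : ClosedUnderExtensions S) :
    IsRelGenerator G (F ∩ G) := by
  refine ⟨Set.inter_subset_right, fun X hX ↦ ?_⟩
  obtain ⟨X', W, i, p, hX', hW, hse⟩ := h.1.2.2.2 X (h.1.2.1 hX)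
  exact ⟨X', W, i, p, ⟨hW, h.closedUnderExtensions_right hS i p hse hX' hX⟩, hX', hse⟩

lemma mono {T : Set C} (h : IsCotorsionPair.{w} S F G) (hTS : T ⊆ S) (hF : F ⊆ T) (hG : G ⊆ T) :
    IsCotorsionPair.{w} T F G := by
  refine ⟨⟨hF, hG, Set.ext fun A ↦ ?_, fun s hs ↦ h.1.2.2.2 s (hTS hs)⟩,
    ⟨hF, hG, Set.ext fun A ↦ ?_, fun s hs ↦ h.2.2.2.2 s (hTS hs)⟩⟩
  · exact ⟨fun hA ↦ ⟨hF hA, (h.mem_left_iff.1 hA).2⟩,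
      fun hA ↦ h.mem_left_iff.2 ⟨hTS hA.1, hA.2⟩⟩
  · exact ⟨fun hA ↦ ⟨hG hA, (h.mem_right_iff.1 hA).2⟩,
      fun hA ↦ h.mem_right_iff.2 ⟨hTS hA.1, hA.2⟩⟩

lemma closedUnderCokernelsOfMonos_right (h : IsCotorsionPair.{w} S F G)
    (hS : ClosedUnderCokernelsOfMonos S) (hFG : G ⊆ rightPerp.{w} F) :
    ClosedUnderCokernelsOfMonos G := by
  intro A B D f g hfg hA hB
  refine h.mem_right_iff.2 ⟨hS f g hfg (h.1.2.1 hA) (h.1.2.1 hB), fun Z hZ ↦ ?_⟩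
  have := hFG hA Z hZ 2 two_pos
  have := hFG hB Z hZ 1 one_pos
  exact hfg.subsingleton_ext_cokernel_right Z 1

lemma hasResolutionLength_of_relProjDimLE (h : IsCotorsionPair.{w} S F G)
    (hS : ClosedUnderExtensions S) (hFG : G ⊆ rightPerp.{w} F) {n : ℕ} {M : C} (hM : M ∈ G)
    (hn : relProjDimLE.{w} G M n) : HasResolutionLength (F ∩ G) n M := by
  induction n generalizing M with
  | zero =>
    exact .zero ⟨h.mem_left_iff.2 ⟨h.1.2.1 hM, fun Y hY ↦ hn Y hY 1 one_pos⟩, hM⟩ (Iso.refl M)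
  | succ n ih =>
    obtain ⟨K, W, i, p, hW, hK, hse⟩ := (h.isRelGenerator hS).2 M hM
    refine .succ K W hW i p hse (ih hK fun Y hY j hj ↦ ?_)
    have := hFG hY W hW.1 j (by lia)
    have := hn Y hY (j + 1) (by lia)
    exact hse.subsingleton_ext_kernel_left Y j

end IsCotorsionPair

/-- Theorem CP3. Let `C` have enough projectives, `S` be thick,
`(F,G)` an `S`-cotorsion pair with `F` resolving in `C`, and `ω := F ∩ G`. Then
(a) `Ext^i(F,G) = 0` for `i ≥ 1`; (b) `(F,ω)` is a left Frobenius pair; (c) `(ω,G)`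
is a right Frobenius pair; (d) if `G ⊆ F^∧` then `(F,G)` is an `F^∧`-cotorsion pair
and `G = ω^∧ = F^∧ ∩ F^⊥`, `F = F^∧ ∩ ^⊥ω = F^∧ ∩ ^⊥(ω^∧)`. -/
theorem stmt16 [EnoughProjectives C] (S F G : Set C) (hS : IsThickClass S)
    (hpair : IsCotorsionPair S F G) (hres : IsResolvingClass F) :
    (∀ F' ∈ F, ∀ G' ∈ G, ∀ i : ℕ, 1 ≤ i → Subsingleton (Abelian.Ext.{w} F' G' i)) ∧
    LeftFrobeniusPair F (F ∩ G) ∧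
    RightFrobeniusPair (F ∩ G) G ∧
    (G ⊆ resHat F →
      IsCotorsionPair (resHat F) F G ∧
      G = resHat (F ∩ G) ∧
      resHat (F ∩ G) = resHat F ∩ rightPerp F ∧
      F = resHat F ∩ leftPerp (F ∩ G) ∧
      F = resHat F ∩ leftPerp (resHat (F ∩ G))) := by
  have hFG : G ⊆ rightPerp.{w} F := fun _ hG ↦
    hres.rightPerp1_subset_rightPerp (hpair.mem_right_iff.1 hG).2
  have hext : ClosedUnderExtensions S := hS.1.1.1
  have hsumF := hpair.closedUnderSummands_left hS.1.2
  have hsumG := hpair.closedUnderSummands_right hS.1.2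
  have hthickG : IsRightThick G := ⟨⟨hpair.closedUnderExtensions_right hext,
    hpair.closedUnderCokernelsOfMonos_right hS.2.1.2 hFG⟩, hsumG⟩
  refine ⟨fun F' hF' G' hG' i hi ↦ hFG hG' F' hF' i hi,
    ⟨⟨hres.1, hsumF⟩, fun W hW ↦ hFG hW.2, hpair.isRelCogenerator hext, hsumF.inter hsumG⟩,
    ⟨hthickG, fun W hW X hX ↦ hFG hX W hW.1, hpair.isRelGenerator hext, hsumF.inter hsumG⟩,
    fun hG ↦ ?_⟩
  have hFS : resHat F ⊆ S := resHat_subset_s16 hS.2 hpair.1.1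
  have hpair' := hpair.mono hFS (subset_resHat F) hG
  have hGω : G = resHat (F ∩ G) := by
    refine subset_antisymm (fun M hM ↦ ?_) (resHat_subset_s16 hthickG Set.inter_subset_right)
    obtain ⟨n, hn⟩ := hG hM
    exact ⟨n, hpair.hasResolutionLength_of_relProjDimLE hext hFG hM
      (hn.relProjDimLE fun X hX Y hY ↦ hFG hY X hX)⟩
  have hF : F = resHat F ∩ leftPerp.{w} G := subset_antisymm
    (fun X hX ↦ ⟨subset_resHat F hX, fun Y hY ↦ hFG hY X hX⟩)
    (fun X hX ↦ hpair'.mem_left_iff.2 ⟨hX.1, fun Y hY ↦ hX.2 Y hY 1 one_pos⟩)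
  have hperp : leftPerp.{w} (F ∩ G) = leftPerp.{w} G := by
    refine subset_antisymm ?_ fun X hX Y hY ↦ hX Y hY.2
    conv_rhs => rw [hGω]
    exact leftPerp_subset_leftPerp_resHat _
  refine ⟨hpair', hGω, ?_, ?_, ?_⟩
  · rw [← hGω]
    exact subset_antisymm (fun X hX ↦ ⟨hG hX, hFG hX⟩)
      fun X hX ↦ hpair'.mem_right_iff.2 ⟨hX.1, fun Z hZ ↦ hX.2 Z hZ 1 one_pos⟩
  · rwa [hperp]
  · rwa [← hGω]

end ABFormal
end
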